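/- Let P be a pseudo-tree of a query hypergraph Q. Then the pair (P, χ) with χ(A) = anc⁺(A) ∪ out(A) for every A ∈ V is a tree decomposition of Q. Consequently, fhw(Q) ≤ t(P) for every pseudo-tree P of Q. -/

import Mathlib

open scoped Classical

noncomputable section

/-- The fractional edge cover number `ρ*(Y)` of a set `Y` of variables, with respect to the
atoms `X i` (each a finite set of variables). -/
def rhoStar {V ι : Type*} [Fintype ι] [DecidableEq V]
    (X : ι → Finset V) (Y : Set V) : ℝ :=
  sInf {r : ℝ | ∃ w : ι → ℝ, (∀ i, 0 ≤ w i) ∧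
    (∀ A ∈ Y, 1 ≤ ∑ i ∈ Finset.univ.filter (fun i => A ∈ X i), w i) ∧ r = ∑ i, w i}

/-- Closed ancestors `anc⁺(A)` in the rooted tree given by the parent function `par`. -/
def ancc {V : Type*} (par : V → V) (A : V) : Set V := {B | ∃ n : ℕ, par^[n] A = B}

/-- Proper ancestors `anc(A)`. -/
def anc {V : Type*} (par : V → V) (A : V) : Set V := ancc par A \ {A}

/-- Closed descendants `desc⁺(A)`. -/
def descc {V : Type*} (par : V → V) (A : V) : Set V := {B | A ∈ ancc par B}

/-- Proper descendants `desc(A)`. -/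
def descO {V : Type*} (par : V → V) (A : V) : Set V := {B | A ∈ anc par B}

/-- `(root, par)` describes a rooted tree: the root is a fixed point of the parent map and
every node reaches the root by iterating the parent map. -/
def IsRootedTree {V : Type*} (root : V) (par : V → V) : Prop :=
  par root = root ∧ ∀ A : V, ∃ n : ℕ, par^[n] A = root

/-- The rooted tree given by `par` is a pseudo-tree of the query with atoms `X`:
every atom is contained in some branch. -/
def IsPseudoTree {V ι : Type*} (X : ι → Finset V) (par : V → V) : Prop :=
  ∀ i, ∃ A : V, (X i : Set V) ⊆ ancc par A

/-- Space exponent `s(P)` of a pseudo-tree. -/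
def sExp {V ι : Type*} [Fintype V] [Fintype ι] [DecidableEq V]
    (X : ι → Finset V) (Xout : Set V) (par : V → V) : ℝ :=
  ⨆ A : V, rhoStar X (descc par A ∩ Xout)

/-- Time exponent `t(P)` of a pseudo-tree. -/
def tExp {V ι : Type*} [Fintype V] [Fintype ι] [DecidableEq V]
    (X : ι → Finset V) (Xout : Set V) (par : V → V) : ℝ :=
  ⨆ A : V, rhoStar X (ancc par A ∪ (descO par A ∩ Xout))

/-- `(root, par, χ)` is a tree decomposition of the query with atoms `X` and output
variables `Xout`: the output variables are contained in the root bag, for every variable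
the set of bags containing it is connected (expressed via a common ancestor `t` whose
paths down to the two given bags are fully covered), and every atom is covered by a bag. -/
def IsTreeDecomp {V ν ι : Type*} (X : ι → Finset V) (Xout : Set V)
    (root : ν) (par : ν → ν) (χ : ν → Set V) : Prop :=
  Xout ⊆ χ root ∧
  (∀ (A : V) (v w : ν), A ∈ χ v → A ∈ χ w →
    ∃ t : ν, A ∈ χ t ∧ t ∈ ancc par v ∧ t ∈ ancc par w ∧
      (∀ u : ν, u ∈ ancc par v → t ∈ ancc par u → A ∈ χ u) ∧
      (∀ u : ν, u ∈ ancc par w → t ∈ ancc par u → A ∈ χ u)) ∧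
  (∀ i, ∃ v : ν, (X i : Set V) ⊆ χ v)

/-- The `TD(GJ)` space exponent of a tree decomposition:
`max(ρ*(X), max over tree edges (u,v) of ρ*(χ(u) ∩ χ(v)))`. -/
def tdSpace {V ν ι : Type*} [Fintype ν] [Fintype ι] [DecidableEq V]
    (X : ι → Finset V) (Xout : Set V) (root : ν) (par : ν → ν) (χ : ν → Set V) : ℝ :=
  max (rhoStar X Xout) (⨆ v : {v : ν // v ≠ root}, rhoStar X (χ (par v.1) ∩ χ v.1))

/-- The `TD(GJ)` time exponent of a tree decomposition: `max_v ρ*(χ(v))`. -/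
def tdTime {V ν ι : Type*} [Fintype ν] [Fintype ι] [DecidableEq V]
    (X : ι → Finset V) (χ : ν → Set V) : ℝ :=
  ⨆ v : ν, rhoStar X (χ v)

/-- The fractional hypertree width: the infimum of `max_v ρ*(χ(v))` over all (finite)
tree decompositions, encoded with node sets `Fin n`. -/
def fhw {V ι : Type*} [Fintype V] [Fintype ι] [DecidableEq V]
    (X : ι → Finset V) (Xout : Set V) : ℝ :=
  sInf {r : ℝ | ∃ (n : ℕ) (root : Fin n) (par : Fin n → Fin n) (χ : Fin n → Set V),
    IsRootedTree root par ∧ IsTreeDecomp X Xout root par χ ∧ r = tdTime X χ}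

/-- The context `con(A)` of a variable in a pseudo-tree: those proper ancestors `B` of `A`
that share an atom with some closed descendant of `A`. -/
def conSet {V ι : Type*} (X : ι → Finset V) (par : V → V) (A : V) : Set V :=
  {B | B ∈ anc par A ∧ ∃ C ∈ descc par A, ∃ i, B ∈ X i ∧ C ∈ X i}

/-- `B_A`: the deepest cached closed ancestor of `A` (the element of `C ∩ anc⁺(A)` of which
all other elements of `C ∩ anc⁺(A)` are closed ancestors). -/
def lowestCache {V : Type*} (par : V → V) (C : Set V) (A : V) : V :=
  if h : ∃ B, (B ∈ C ∩ ancc par A) ∧ C ∩ ancc par A ⊆ ancc par B then h.choose else A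

/-- Space exponent of a pseudo-tree with caching `(P, C)`. -/
def sPTC {V ι : Type*} [Fintype V] [Fintype ι] [DecidableEq V]
    (X : ι → Finset V) (Xout : Set V) (par : V → V) (C : Set V) : ℝ :=
  ⨆ A : ↥C, rhoStar X (conSet X par A.1 ∪ (descc par A.1 ∩ Xout))

/-- Time exponent of a pseudo-tree with caching `(P, C)`:
`max_A ρ*(con(B_A) ∪ [A, B_A] ∪ out(A))`. -/
def tPTC {V ι : Type*} [Fintype V] [Fintype ι] [DecidableEq V]
    (X : ι → Finset V) (Xout : Set V) (par : V → V) (C : Set V) : ℝ :=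
  ⨆ A : V, rhoStar X (conSet X par (lowestCache par C A)
    ∪ {u | u ∈ ancc par A ∧ lowestCache par C A ∈ ancc par u}
    ∪ (descO par A ∩ Xout))

/-- Depth of a node in the rooted tree. -/
def tdepth {V : Type*} (root : V) (par : V → V) (A : V) : ℕ :=
  sInf {n : ℕ | par^[n] A = root}

/-- The stored context `scon(A)` of a PTCR `(P, C)`: the `min(C A, |con(A)|)` deepest
elements of `con(A)`. -/
def sconSet {V ι : Type*} (X : ι → Finset V) (root : V) (par : V → V)
    (Csize : V → ℕ) (A : V) : Set V :=
  {B | B ∈ conSet X par A ∧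
    Set.ncard {B' | B' ∈ conSet X par A ∧ tdepth root par B < tdepth root par B'}
      < min (Csize A) (conSet X par A).ncard}

/-- The instantiated context `icon(A)` of a PTCR `(P, C)`. -/
def iconSet {V ι : Type*} (X : ι → Finset V) (root : V) (par : V → V)
    (Csize : V → ℕ) (A : V) : Set V :=
  conSet X par A \ sconSet X root par Csize A

/-- Space exponent of a PTCR: `max_A ρ*(scon(A) ∪ out⁺(A))`. -/
def sPTCR {V ι : Type*} [Fintype V] [Fintype ι] [DecidableEq V]
    (X : ι → Finset V) (Xout : Set V) (root : V) (par : V → V) (Csize : V → ℕ) : ℝ :=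
  ⨆ A : V, rhoStar X (sconSet X root par Csize A ∪ (descc par A ∩ Xout))

/-- Time exponent of a PTCR: `max_A ρ*(ra(A) ∪ out(A))`, where the relevant-ancestor
function `ra` is supplied (it is determined by its defining top-down recurrence). -/
def tPTCR {V ι : Type*} [Fintype V] [Fintype ι] [DecidableEq V]
    (X : ι → Finset V) (Xout : Set V) (par : V → V) (ra : V → Set V) : ℝ :=
  ⨆ A : V, rhoStar X (ra A ∪ (descO par A ∩ Xout))

end

theorem self_mem_ancc {V : Type*} (par : V → V) (A : V) : A ∈ ancc par A := ⟨0, rfl⟩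

theorem ancc_trans {V : Type*} {par : V → V} {A B C : V}
    (hAB : A ∈ ancc par B) (hBC : B ∈ ancc par C) : A ∈ ancc par C := by
  obtain ⟨m, rfl⟩ := hAB
  obtain ⟨n, rfl⟩ := hBC
  exact ⟨m + n, Function.iterate_add_apply par m n C⟩

theorem ancc_comparable {V : Type*} {par : V → V} {A B C : V}
    (hA : A ∈ ancc par C) (hB : B ∈ ancc par C) : A ∈ ancc par B ∨ B ∈ ancc par A := by
  obtain ⟨m, rfl⟩ := hA
  obtain ⟨n, rfl⟩ := hB
  rcases le_total m n with h | h
  · right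
    exact ⟨n - m, by rw [← Function.iterate_add_apply, Nat.sub_add_cancel h]⟩
  · left
    exact ⟨m - n, by rw [← Function.iterate_add_apply, Nat.sub_add_cancel h]⟩

/-- A variable lies in the bag `anc⁺(v) ∪ out(v)` iff it is a closed ancestor of `v`, or an
output variable having `v` as a closed ancestor. -/
theorem mem_ancc_union_out_iff {V : Type*} {par : V → V} {Xout : Set V} {A v : V} :
    A ∈ ancc par v ∪ (descO par v ∩ Xout) ↔ A ∈ ancc par v ∨ (v ∈ ancc par A ∧ A ∈ Xout) := by
  constructor
  · rintro (h | ⟨h, hX⟩)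
    · exact Or.inl h
    · exact Or.inr ⟨h.1, hX⟩
  · rintro (h | ⟨h, hX⟩)
    · exact Or.inl h
    · by_cases hvA : v = A
      · exact Or.inl (hvA ▸ self_mem_ancc par v)
      · exact Or.inr ⟨⟨h, hvA⟩, hX⟩

theorem IsPseudoTree.isTreeDecomp {V ι : Type*} {X : ι → Finset V} {root : V} {par : V → V}
    (hPT : IsPseudoTree X par) (hT : IsRootedTree root par) (Xout : Set V) :
    IsTreeDecomp X Xout root par (fun A => ancc par A ∪ (descO par A ∩ Xout)) := by
  refine ⟨fun A hA => mem_ancc_union_out_iff.2 (Or.inr ⟨hT.2 A, hA⟩), ?_, fun i => ?_⟩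
  · intro A v w hv hw
    simp only [mem_ancc_union_out_iff] at hv hw ⊢
    by_cases hA : A ∈ Xout
    · have path : ∀ x u : V, (A ∈ ancc par x ∨ (x ∈ ancc par A ∧ A ∈ Xout)) → u ∈ ancc par x →
          A ∈ ancc par u ∨ (u ∈ ancc par A ∧ A ∈ Xout) := by
        rintro x u (hx | hx) hu
        · exact (ancc_comparable hx hu).imp_right fun h => ⟨h, hA⟩
        · exact Or.inr ⟨ancc_trans hu hx.1, hA⟩
      exact ⟨root, Or.inr ⟨hT.2 A, hA⟩, hT.2 v, hT.2 w, fun u hu _ => path v u hv hu,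
        fun u hu _ => path w u hw hu⟩
    · have hv' := hv.resolve_right fun h => hA h.2
      have hw' := hw.resolve_right fun h => hA h.2
      exact ⟨A, Or.inl (self_mem_ancc par A), hv', hw', fun _ _ h => Or.inl h,
        fun _ _ h => Or.inl h⟩
  · obtain ⟨A, hA⟩ := hPT i
    exact ⟨A, hA.trans Set.subset_union_left⟩

theorem Equiv.iterate_conj_apply {ν μ : Type*} (e : ν ≃ μ) (par : ν → ν) (n : ℕ) (v : μ) :
    (e ∘ par ∘ e.symm)^[n] v = e (par^[n] (e.symm v)) := by
  have h : Function.Semiconj e par (e ∘ par ∘ e.symm) := fun x => by simp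
  simpa using ((h.iterate_right n) (e.symm v)).symm

theorem mem_ancc_conj_iff {ν μ : Type*} (e : ν ≃ μ) (par : ν → ν) (u v : μ) :
    u ∈ ancc (e ∘ par ∘ e.symm) v ↔ e.symm u ∈ ancc par (e.symm v) := by
  simp only [ancc, Set.mem_ofPred_eq, Equiv.iterate_conj_apply, Equiv.eq_symm_apply]

theorem IsRootedTree.conj {ν μ : Type*} {root : ν} {par : ν → ν} (hT : IsRootedTree root par)
    (e : ν ≃ μ) : IsRootedTree (e root) (e ∘ par ∘ e.symm) := by
  refine ⟨by simp [hT.1], fun A => ?_⟩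
  obtain ⟨n, hn⟩ := hT.2 (e.symm A)
  exact ⟨n, by rw [Equiv.iterate_conj_apply, hn]⟩

theorem IsTreeDecomp.conj {V ν μ ι : Type*} {X : ι → Finset V} {Xout : Set V} {root : ν}
    {par : ν → ν} {χ : ν → Set V} (hD : IsTreeDecomp X Xout root par χ) (e : ν ≃ μ) :
    IsTreeDecomp X Xout (e root) (e ∘ par ∘ e.symm) (χ ∘ e.symm) := by
  obtain ⟨hout, hconn, hatom⟩ := hD
  refine ⟨by simpa using hout, fun A v w hv hw => ?_, fun i => ?_⟩
  · obtain ⟨t, hAt, htv, htw, h₁, h₂⟩ := hconn A _ _ hv hw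
    refine ⟨e t, ?_⟩
    simp only [mem_ancc_conj_iff, Function.comp_apply, Equiv.symm_apply_apply]
    exact ⟨hAt, htv, htw, fun u => h₁ _, fun u => h₂ _⟩
  · obtain ⟨v, hv⟩ := hatom i
    exact ⟨e v, by simpa using hv⟩

theorem rhoStar_nonneg {V ι : Type*} [Fintype ι] [DecidableEq V] (X : ι → Finset V)
    (Y : Set V) : 0 ≤ rhoStar X Y := by
  apply Real.sInf_nonneg
  rintro r ⟨w, hw, -, rfl⟩
  exact Finset.sum_nonneg fun i _ => hw i

theorem fhw_le_tdTime {V ν ι : Type*} [Fintype V] [Fintype ν] [Fintype ι] [DecidableEq V]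
    {X : ι → Finset V} {Xout : Set V} {root : ν} {par : ν → ν} {χ : ν → Set V}
    (hT : IsRootedTree root par) (hD : IsTreeDecomp X Xout root par χ) :
    fhw X Xout ≤ tdTime X χ := by
  refine csInf_le ⟨0, ?_⟩ ?_
  · rintro r ⟨n, root', par', χ', -, -, rfl⟩
    exact Real.iSup_nonneg fun v => rhoStar_nonneg X (χ' v)
  · let e := Fintype.equivFin ν
    exact ⟨_, e root, e ∘ par ∘ e.symm, χ ∘ e.symm, hT.conj e, hD.conj e,
      (e.symm.iSup_comp (g := fun v => rhoStar X (χ v))).symm⟩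

/-- For every pseudo-tree `P` of a query hypergraph `Q`, the pair
`(P, χ)` with `χ(A) = anc⁺(A) ∪ out(A)` is a tree decomposition of `Q`; consequently
`fhw(Q) ≤ t(P)`. -/
theorem stmt_12 {V ι : Type*} [Fintype V] [DecidableEq V] [Fintype ι]
    (X : ι → Finset V) (hvar : ∀ A : V, ∃ i, A ∈ X i) (Xout : Set V)
    (root : V) (par : V → V)
    (hT : IsRootedTree root par) (hPT : IsPseudoTree X par) :
    IsTreeDecomp X Xout root par (fun A => ancc par A ∪ (descO par A ∩ Xout)) ∧
    fhw X Xout ≤ tExp X Xout par := by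
  exact ⟨hPT.isTreeDecomp hT Xout, fhw_le_tdTime hT (hPT.isTreeDecomp hT Xout)⟩
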